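/- For all integers n \ge 1, the quantity \mathfrak{d}_n := p_{n-1} q_n - p_n q_{n-1} satisfies the recurrence \mathfrak{d}_n = (n-1)^2 \mathfrak{d}_{n-1} + \frac{n-2}{n} q_{n-1}, where q_n = \sum_{k=0}^n \binom{n}{k}^2 k!, p_n = \sum_{k=0}^n \binom{n}{k}^2 k! (2 H_{n-k} - H_k), p_{-1} = 1, q_{-1} = 0. -/

import Mathlib

open Finset

noncomputable def H (m : ℕ) : ℚ := ∑ j ∈ Finset.range m, (1 : ℚ) / (j + 1)

noncomputable def q (n : ℕ) : ℚ :=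
  ∑ k ∈ Finset.range (n + 1), ((n.choose k : ℚ))^2 * (Nat.factorial k : ℚ)

noncomputable def p (n : ℕ) : ℚ :=
  ∑ k ∈ Finset.range (n + 1),
    ((n.choose k : ℚ))^2 * (Nat.factorial k : ℚ) * (2 * H (n - k) - H k)

/-- `dd n = p_{n-1} q_n - p_n q_{n-1}`, with the conventions `p_{-1} = 1`, `q_{-1} = 0`,
so `dd 0 = 1`. -/
noncomputable def dd : ℕ → ℚ
  | 0 => 1
  | (n + 1) => p n * q (n + 1) - p (n + 1) * q n

theorem H_succ (m : ℕ) : H (m + 1) = H m + 1 / ((m : ℚ) + 1) := by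
  simp [H, Finset.sum_range_succ]

theorem choose_sq_mul_factorial (a b : ℕ) :
    (((a + b).choose b : ℚ)) ^ 2 * (b.factorial : ℚ) =
      ((a + b).factorial : ℚ) ^ 2 / ((b.factorial : ℚ) * (a.factorial : ℚ) ^ 2) := by
  have hb : (b.factorial : ℚ) ≠ 0 := by exact_mod_cast b.factorial_ne_zero
  have ha : (a.factorial : ℚ) ≠ 0 := by exact_mod_cast a.factorial_ne_zero
  have h : ((a + b).choose b : ℚ) * a.factorial * b.factorial = (a + b).factorial := by
    have := Nat.add_choose_mul_factorial_mul_factorial a b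
    exact_mod_cast this
  rw [← h]
  field_simp

theorem q_partial_sum (m : ℕ) : ∀ d : ℕ,
    ∑ k ∈ Finset.range (m + 1),
      ((((m + d + 2).choose k : ℚ)) ^ 2 * (k.factorial : ℚ)
        - 2 * ((m : ℚ) + d + 2) * ((((m + d + 1).choose k : ℚ)) ^ 2 * (k.factorial : ℚ))
        + ((m : ℚ) + d + 1) ^ 2 * ((((m + d).choose k : ℚ)) ^ 2 * (k.factorial : ℚ))) =
      (((m + d + 1).choose m : ℚ)) ^ 2 * (m.factorial : ℚ) *
        (((d : ℚ) + 1) * d - (m + d + 2)) := by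
  induction m with
  | zero => intro d; simp; ring
  | succ m ih =>
    intro d
    have h := ih (d + 1)
    rw [Finset.sum_range_succ]
    rw [show m + (d + 1) = m + 1 + d by ring] at h
    push_cast at h ⊢
    rw [show (m : ℚ) + (d + 1) = m + 1 + d by ring] at h
    rw [h]
    have e0 := choose_sq_mul_factorial d (m + 1)
    have e1 := choose_sq_mul_factorial (d + 1) (m + 1)
    have e2 := choose_sq_mul_factorial (d + 2) (m + 1)
    have e3 := choose_sq_mul_factorial (d + 2) m
    rw [show d + (m + 1) = m + 1 + d by ring] at e0
    rw [show d + 1 + (m + 1) = m + 1 + d + 1 by ring] at e1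
    rw [show d + 2 + (m + 1) = m + 1 + d + 2 by ring] at e2
    rw [show d + 2 + m = m + 1 + d + 1 by ring] at e3
    rw [e0, e1, e2, e3]
    have hm : (m.factorial : ℚ) ≠ 0 := by exact_mod_cast m.factorial_ne_zero
    have hd : (d.factorial : ℚ) ≠ 0 := by exact_mod_cast d.factorial_ne_zero
    simp only [Nat.factorial_succ]
    push_cast
    field_simp
    ring

theorem p_partial_sum (m : ℕ) : ∀ d : ℕ,
    ∑ k ∈ Finset.range (m + 1),
      ((((m + d + 2).choose k : ℚ)) ^ 2 * (k.factorial : ℚ) * (2 * H (m + d + 2 - k) - H k)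
        - 2 * ((m : ℚ) + d + 2) * ((((m + d + 1).choose k : ℚ)) ^ 2 * (k.factorial : ℚ)
            * (2 * H (m + d + 1 - k) - H k))
        + ((m : ℚ) + d + 1) ^ 2 * ((((m + d).choose k : ℚ)) ^ 2 * (k.factorial : ℚ)
            * (2 * H (m + d - k) - H k))) =
      (((m + d + 1).choose m : ℚ)) ^ 2 * (m.factorial : ℚ) *
        ((((d : ℚ) + 1) * d - (m + d + 2)) * (2 * H (d + 1) - H m) - (2 * d + 1))
        - ((m : ℚ) + d) / (m + d + 2) := by
  induction m with
  | zero =>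
    intro d
    have h0 : H 0 = 0 := by simp [H]
    simp [H_succ, h0]
    field_simp
    ring
  | succ m ih =>
    intro d
    have h := ih (d + 1)
    rw [Finset.sum_range_succ]
    rw [show m + (d + 1) = m + 1 + d by ring] at h
    push_cast at h ⊢
    rw [show (m : ℚ) + (d + 1) = m + 1 + d by ring] at h
    rw [h]
    have e0 := choose_sq_mul_factorial d (m + 1)
    have e1 := choose_sq_mul_factorial (d + 1) (m + 1)
    have e2 := choose_sq_mul_factorial (d + 2) (m + 1)
    have e3 := choose_sq_mul_factorial (d + 2) m
    rw [show d + (m + 1) = m + 1 + d by ring] at e0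
    rw [show d + 1 + (m + 1) = m + 1 + d + 1 by ring] at e1
    rw [show d + 2 + (m + 1) = m + 1 + d + 2 by ring] at e2
    rw [show d + 2 + m = m + 1 + d + 1 by ring] at e3
    rw [e0, e1, e2, e3]
    rw [show m + 1 + d + 1 - m = d + 1 + 1 by omega,
      show m + 1 + d - m = d + 1 by omega, show m + 1 + d - (m + 1) = d by omega]
    have hm : (m.factorial : ℚ) ≠ 0 := by exact_mod_cast m.factorial_ne_zero
    have hd : (d.factorial : ℚ) ≠ 0 := by exact_mod_cast d.factorial_ne_zero
    simp only [Nat.factorial_succ, H_succ]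
    push_cast
    field_simp
    ring

theorem q_recurrence (n : ℕ) :
    q (n + 2) - 2 * ((n : ℚ) + 2) * q (n + 1) + ((n : ℚ) + 1) ^ 2 * q n = 0 := by
  have h := q_partial_sum n 0
  simp only [Finset.sum_add_distrib, Finset.sum_sub_distrib, ← Finset.mul_sum] at h
  simp only [q, Finset.sum_range_succ _ (n + 2), Finset.sum_range_succ _ (n + 1)]
  have c : (n + 2).choose (n + 1) = n + 2 := Nat.choose_succ_self_right (n + 1)
  simp only [Nat.choose_self, c, Nat.choose_succ_self_right, add_zero, Nat.cast_zero,
    Nat.factorial_succ] at h ⊢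
  push_cast at h ⊢
  linear_combination h

theorem p_recurrence (n : ℕ) :
    p (n + 2) - 2 * ((n : ℚ) + 2) * p (n + 1) + ((n : ℚ) + 1) ^ 2 * p n
      = -((n : ℚ) / (n + 2)) := by
  have h := p_partial_sum n 0
  simp only [Finset.sum_add_distrib, Finset.sum_sub_distrib, ← Finset.mul_sum] at h
  simp only [p, Finset.sum_range_succ _ (n + 2), Finset.sum_range_succ _ (n + 1)]
  have c : (n + 2).choose (n + 1) = n + 2 := Nat.choose_succ_self_right (n + 1)
  have h0 : H 0 = 0 := by simp [H]
  have s : n + 2 - (n + 1) = 0 + 1 := by omega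
  have hs : H (n + 2) = H n + 1 / ((n : ℚ) + 1) + 1 / ((n : ℚ) + 1 + 1) := by
    rw [H_succ, H_succ]; push_cast; rfl
  simp only [Nat.choose_self, c, Nat.choose_succ_self_right, add_zero, Nat.cast_zero,
    Nat.factorial_succ, Nat.sub_self, s, hs, H_succ, h0] at h ⊢
  push_cast at h ⊢
  generalize ∑ x ∈ range (n + 1), ((n + 2).choose x : ℚ) ^ 2 * (x.factorial : ℚ)
    * (2 * H (n + 2 - x) - H x) = A at h ⊢
  generalize ∑ x ∈ range (n + 1), ((n + 1).choose x : ℚ) ^ 2 * (x.factorial : ℚ)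
    * (2 * H (n + 1 - x) - H x) = B at h ⊢
  generalize ∑ x ∈ range (n + 1), (n.choose x : ℚ) ^ 2 * (x.factorial : ℚ)
    * (2 * H (n - x) - H x) = C at h ⊢
  linear_combination (norm := skip) h
  field_simp
  ring

theorem dd_recurrence (n : ℕ) (hn : 1 ≤ n) :
    dd n = ((n : ℚ) - 1)^2 * dd (n - 1) + ((n : ℚ) - 2) / (n : ℚ) * q (n - 1) := by
  obtain _ | _ | n := n
  · omega
  · norm_num [dd, p, q, H, Finset.sum_range_succ]
  · have hq := q_recurrence n
    have hp := p_recurrence n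
    simp only [dd, add_assoc, Nat.reduceAdd]
    push_cast
    rw [show ((n : ℚ) + 2 - 2) = n by ring, show (n : ℚ) + 2 - 1 = n + 1 by ring]
    linear_combination p (n + 1) * hq - q (n + 1) * hp
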